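/- (Theorem 1, receiver for a desired direction.) Let K ≥ 1 and let α : Fin K → ℝ be such that the family (1, α 0, …, α (K−1)) is linearly independent over ℚ. Define the array gain g(a, n) = 1 + cos(2·π·n·a) for a ∈ ℝ and n ∈ ℕ. Then for every index i : Fin K and every δ > 0 there exists a positive integer n such that g(α k, n) < δ for all k ≠ i, while g(α i, n) > 1 − δ. -/

import Mathlib

open Real

/-- Squared beam-pattern gain of the two-element beamformer `w_n = (e₀ + e_n)/√2`
at a direction with cosine `a`: `g(a, n) = 1 + cos(2πna)`. -/
noncomputable def arrayGain (a : ℝ) (n : ℕ) : ℝ :=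
  1 + Real.cos (2 * Real.pi * n * a)

open MeasureTheory Filter

namespace UnitAddTorus

variable {d : Type*} [Fintype d]

lemma mFourier_apply_add (n : d → ℤ) (x y : UnitAddTorus d) :
    mFourier n (x + y) = mFourier n x * mFourier n y := by
  simp only [mFourier, ContinuousMap.coe_mk, ← Finset.prod_mul_distrib, Pi.add_apply,
    fourier_apply, smul_add, AddCircle.toCircle_add, Circle.coe_mul]

lemma mFourier_coe (n : d → ℤ) (a : d → ℝ) :
    mFourier n (fun k ↦ (a k : UnitAddCircle)) =
      Complex.exp (2 * π * Complex.I * ∑ k, n k * (a k : ℂ)) := by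
  simp only [mFourier, ContinuousMap.coe_mk, fourier_coe_apply, ← Complex.exp_sum,
    Finset.mul_sum, Complex.ofReal_one, div_one, mul_assoc]

lemma mFourierCoeff_comp_add_right (f : UnitAddTorus d → ℂ) (a : UnitAddTorus d) (n : d → ℤ) :
    mFourierCoeff (fun x ↦ f (x + a)) n = mFourier n a * mFourierCoeff f n := by
  have key : ∀ t, mFourier (-n) t • f (t + a) =
      mFourier n a * (mFourier (-n) (t + a) • f (t + a)) := fun t ↦ by
    have h : mFourier n a * mFourier (-n) a = 1 := by
      rw [← mFourier_add, add_neg_cancel, mFourier_zero, ContinuousMap.one_apply]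
    simp only [mFourier_apply_add, smul_eq_mul]
    linear_combination (-(mFourier (-n) t * f (t + a))) * h
  change ∫ t, mFourier (-n) t • f (t + a) ∂(Measure.pi fun _ ↦ AddCircle.haarAddCircle) =
    mFourier n a * ∫ t, mFourier (-n) t • f t ∂(Measure.pi fun _ ↦ AddCircle.haarAddCircle)
  simp_rw [key]
  rw [integral_const_mul, integral_add_right_eq_self (fun t ↦ mFourier (-n) t • f t) a]

/-- A continuous function on the torus which is invariant under a translation that is not in the
kernel of any nontrivial character is constant. -/
lemma apply_eq_mFourierCoeff_zero_of_invariant {a : UnitAddTorus d}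
    (ha : ∀ n : d → ℤ, n ≠ 0 → mFourier n a ≠ 1) {f : C(UnitAddTorus d, ℂ)}
    (hf : ∀ x, f (x + a) = f x) (x : UnitAddTorus d) : f x = mFourierCoeff f 0 := by
  have h0 : ∀ n, n ≠ 0 → mFourierCoeff f n = 0 := fun n hn ↦ by
    have h := mFourierCoeff_comp_add_right f a n
    simp_rw [hf] at h
    by_contra hne
    exact ha n hn (mul_right_cancel₀ hne (by rw [one_mul]; exact h.symm))
  have hs := hasSum_mFourier_series_apply_of_summable
    (summable_of_ne_finset_zero (s := {0}) fun n hn ↦ h0 n (by simpa using hn)) x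
  refine hs.unique ?_
  simpa [mFourier_zero] using
    hasSum_single (f := fun n ↦ mFourierCoeff f n • mFourier n x) 0
      fun n hn ↦ by simp [h0 n hn]

/-- **Kronecker's theorem**: the multiples of a point of the torus are dense if no nontrivial
character is trivial at this point. -/
theorem denseRange_zsmul {a : UnitAddTorus d}
    (ha : ∀ n : d → ℤ, n ≠ 0 → mFourier n a ≠ 1) : DenseRange (fun m : ℤ ↦ m • a) := by
  set S := Set.range fun m : ℤ ↦ m • a
  have hS : S.Nonempty := Set.range_nonempty _
  have himage : (· + a) '' S = S := by
    refine (Set.range_comp _ _).symm.trans (.trans (congrArg Set.range (funext fun m ↦ ?_))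
      ((Equiv.addRight (1 : ℤ)).surjective.range_comp fun m : ℤ ↦ m • a))
    simp [add_smul]
  let f : C(UnitAddTorus d, ℂ) :=
    ⟨fun x ↦ (Metric.infDist x S : ℂ),
      Complex.continuous_ofReal.comp (Metric.continuous_infDist_pt S)⟩
  have hf : ∀ x, f (x + a) = f x := fun x ↦ by
    have h := Metric.infDist_image (x := x) (t := S) (isometry_add_right a)
    rw [himage] at h
    exact congrArg Complex.ofReal h
  intro x
  rw [Metric.mem_closure_iff_infDist_zero hS, ← Complex.ofReal_eq_zero]
  have h0 : f 0 = 0 := by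
    simpa [f] using Metric.infDist_zero_of_mem (show (0 : UnitAddTorus d) ∈ S from ⟨0, by simp⟩)
  change f x = 0
  rw [apply_eq_mFourierCoeff_zero_of_invariant ha hf x,
    ← apply_eq_mFourierCoeff_zero_of_invariant ha hf 0, h0]

lemma mFourier_coe_ne_one {K : ℕ} {α : Fin K → ℝ}
    (hα : LinearIndependent ℚ (Fin.cons (1 : ℝ) α : Fin (K + 1) → ℝ)) (n : Fin K → ℤ)
    (hn : n ≠ 0) : mFourier n (fun k ↦ (α k : UnitAddCircle)) ≠ 1 := by
  rw [mFourier_coe, Ne, Complex.exp_eq_one_iff]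
  rintro ⟨m, hm⟩
  have hsum : ∑ k, (n k : ℝ) * α k = m := by
    have : (∑ k, (n k : ℂ) * α k) = m :=
      mul_left_cancel₀ Complex.two_pi_I_ne_zero (by rw [hm, mul_comm])
    exact_mod_cast this
  have hzero := Fintype.linearIndependent_iff.mp hα
    (Fin.cons (-m : ℚ) fun k ↦ (n k : ℚ)) (by
      simp [Fin.sum_univ_succ, Rat.smul_def, hsum])
  refine hn (funext fun k ↦ ?_)
  simpa using hzero k.succ

end UnitAddTorus

lemma arrayGain_eq_re_fourier (a : ℝ) (n : ℕ) :
    arrayGain a n = 1 + (fourier 1 (n • (a : UnitAddCircle))).re := by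
  rw [← AddCircle.coe_nsmul, fourier_coe_apply, arrayGain, ← Complex.exp_ofReal_mul_I_re]
  congr 3
  push_cast [nsmul_eq_mul]
  ring

/-- **Theorem 1 (receiver for a desired direction).**
If `1, α 0, …, α (K-1)` are linearly independent over `ℚ`, then for every index `i`
and every `δ > 0` there is a positive integer `n` with `g(α k, n) < δ` for all `k ≠ i`
and `g(α i, n) > 1 - δ`. -/
theorem exists_beamformer_for_desired_direction
    (K : ℕ) (hK : 1 ≤ K) (α : Fin K → ℝ)
    (hα : LinearIndependent ℚ (Fin.cons (1 : ℝ) α : Fin (K + 1) → ℝ))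
    (i : Fin K) (δ : ℝ) (hδ : 0 < δ) :
    ∃ n : ℕ, 0 < n ∧ (∀ k : Fin K, k ≠ i → arrayGain (α k) n < δ) ∧
      arrayGain (α i) n > 1 - δ := by
  set a : UnitAddTorus (Fin K) := fun k ↦ (α k : UnitAddCircle)
  let y : UnitAddTorus (Fin K) := fun k ↦ if k = i then 0 else ((1 / 2 : ℝ) : UnitAddCircle)
  have hy : MapClusterPt y atTop (fun n : ℕ ↦ n • a) :=
    ((mapClusterPt_atTop_nsmul_tfae y a).out 0 3).mpr
      (UnitAddTorus.denseRange_zsmul (UnitAddTorus.mFourier_coe_ne_one hα) y)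
  have hcont : ∀ k, Continuous fun x : UnitAddTorus (Fin K) ↦ 1 + (fourier 1 (x k)).re := by
    intro k
    fun_prop
  have hnear : ∀ᶠ x in nhds y, (∀ k, k ≠ i → 1 + (fourier 1 (x k)).re < δ) ∧
      1 + (fourier 1 (x i)).re > 1 - δ := by
    refine .and (eventually_all.mpr fun k ↦ ?_) ?_
    · by_cases hk : k = i
      · simp [hk]
      · refine ((hcont k).continuousAt.eventually_lt_const ?_).mono fun x hx _ ↦ hx
        have hval : 2 * (π : ℂ) * Complex.I * 2⁻¹ = π * Complex.I := by ring
        simp only [y, if_neg hk, fourier_coe_apply]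
        simpa [hval] using hδ
    · refine (hcont i).continuousAt.eventually_const_lt ?_
      simp only [y, if_true, fourier_eval_zero, Complex.one_re]
      linarith
  obtain ⟨n, hn, hpos⟩ := ((hy.frequently hnear).and_eventually (eventually_gt_atTop 0)).exists
  refine ⟨n, hpos, fun k hk ↦ ?_, ?_⟩
  · rw [arrayGain_eq_re_fourier]
    exact hn.1 k hk
  · rw [arrayGain_eq_re_fourier]
    exact hn.2
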